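/- arXiv:1301.0049 — 4 statements merged into one kernel-verified Lean document; each statement's English description precedes it below -/
import Mathlib

section
/- Suppose x ∈ K = LaurentSeries ℝ satisfies the torsion-cosmology evolution equation in Laurent-series form: −(3/2)·((1/2)·(y − 4·x)·g + x·θ(g)) = (ã₀/(2·ã₁))·((3/μ̃)·D − 3·X⁻³) + (9/2)·x·g + (3/4)·x·g². Then x.coeff n = 0 for every integer n < −4. (Equivalently, the torsion density ρ_T/ρ_m⁽⁰⁾ = x − χ·X⁻⁴ − X⁻³ has no terms below degree −4, i.e. ρ_T = O(a⁻⁴) in the high-redshift regime a ≪ 1.) -/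
/-- Below the sum of two lower bounds for the supports, a product of Laurent series vanishes. -/
theorem LaurentSeries.coeff_mul_of_lt {R : Type*} [Semiring R] {f h : LaurentSeries R} {p q n : ℤ}
    (hf : ∀ i < p, f.coeff i = 0) (hh : ∀ i < q, h.coeff i = 0) (hn : n < p + q) :
    (f * h).coeff n = 0 := by
  rw [HahnSeries.coeff_mul]
  refine Finset.sum_eq_zero fun ij hij => ?_
  rw [Finset.mem_antidiagonal] at hij
  rcases lt_or_ge ij.1 p with hp | hp
  · rw [hf _ hp, zero_mul]
  · rw [hh _ (by omega), mul_zero]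

/-- At the sum of two lower bounds for the supports, the coefficient of a product of Laurent series
is the product of the coefficients. -/
theorem LaurentSeries.coeff_mul_add {R : Type*} [Semiring R] {f h : LaurentSeries R} {p q : ℤ}
    (hf : ∀ i < p, f.coeff i = 0) (hh : ∀ i < q, h.coeff i = 0) :
    (f * h).coeff (p + q) = f.coeff p * h.coeff q := by
  rw [HahnSeries.coeff_mul, Finset.sum_eq_single (p, q)]
  · intro ij hij hne
    rw [Finset.mem_antidiagonal] at hij
    rcases lt_or_ge ij.1 p with hp | hp
    · rw [hf _ hp, zero_mul]
    · have : ij.2 < q := by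
        refine lt_of_le_of_ne (by omega) fun h2 => hne (Prod.ext ?_ h2)
        change ij.1 = p
        omega
      rw [hh _ this, mul_zero]
  · intro hnot
    rw [Finset.mem_antidiagonal] at hnot
    simp only [HahnSeries.mem_support, and_true] at hnot
    by_cases h1 : f.coeff p = 0
    · simp [h1]
    · have h2 : h.coeff q = 0 := by tauto
      simp [h2]

/-- paper's Theorem 1, ρ_T = O(a⁻⁴): in `K = LaurentSeries ℝ`, with
`y.coeff n = (n+4)·x.coeff n`, `z.coeff n = n(n+4)·x.coeff n`, `D = ã₁·y + ã₀·X⁻³`,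
`N = ã₁·z − 3ã₀·X⁻³`, `g = N/D`, and `θg` the series with `(θg).coeff n = n·g.coeff n`,
if `x` satisfies the torsion-cosmology evolution equation
`−(3/2)·((1/2)(y − 4x)·g + x·θg) = (ã₀/(2ã₁))·((3/μ̃)·D − 3·X⁻³) + (9/2)·x·g + (3/4)·x·g²`,
then `x.coeff n = 0` for every integer `n < −4`. -/
theorem stmt1 (a0 a1 : ℝ) (ha0 : 0 < a0) (ha1 : 0 < a1)
    (μ : ℝ) (hμ : μ = a0 + a1)
    (x y z D N g θg : LaurentSeries ℝ)
    (hy : ∀ n : ℤ, y.coeff n = ((n : ℝ) + 4) * x.coeff n)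
    (hz : ∀ n : ℤ, z.coeff n = (n : ℝ) * ((n : ℝ) + 4) * x.coeff n)
    (hD : D = a1 • y + a0 • (HahnSeries.single (-3 : ℤ) (1 : ℝ)))
    (hN : N = a1 • z - (3 * a0) • (HahnSeries.single (-3 : ℤ) (1 : ℝ)))
    (hg : g = N / D)
    (hθg : ∀ n : ℤ, θg.coeff n = (n : ℝ) * g.coeff n)
    (heq : (-(3 / 2) : ℝ) • ((1 / 2 : ℝ) • ((y - (4 : ℝ) • x) * g) + x * θg)
        = (a0 / (2 * a1)) • ((3 / μ) • D
            - (3 : ℝ) • (HahnSeries.single (-3 : ℤ) (1 : ℝ)))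
          + (9 / 2 : ℝ) • (x * g) + (3 / 4 : ℝ) • (x * g ^ 2)) :
    ∀ n : ℤ, n < -4 → x.coeff n = 0 := by
  by_contra! hx
  obtain ⟨k, hk, hxk⟩ := hx
  have hx0 : x ≠ 0 := by
    rintro rfl
    exact hxk HahnSeries.coeff_zero
  set m : ℤ := x.order with hm
  have hxlt : ∀ i < m, x.coeff i = 0 := fun i hi => HahnSeries.coeff_eq_zero_of_lt_order hi
  have hm4 : m < -4 := lt_of_le_of_lt (HahnSeries.order_le_of_coeff_ne_zero hxk) hk
  have hc : x.coeff m ≠ 0 := HahnSeries.coeff_order_eq_zero.not.mpr hx0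
  have hm4R : (m : ℝ) ≤ -5 := by exact_mod_cast (by omega : m ≤ -5)
  have hDc : ∀ i ≤ m, D.coeff i = a1 * (((i : ℝ) + 4) * x.coeff i) := by
    intro i hi
    have : i ≠ -3 := by omega
    simp [hD, hy, HahnSeries.coeff_single_of_ne this]
  have hNc : ∀ i ≤ m, N.coeff i = a1 * ((i : ℝ) * ((i : ℝ) + 4) * x.coeff i) := by
    intro i hi
    have : i ≠ -3 := by omega
    simp [hN, hz, HahnSeries.coeff_single_of_ne this]
  have hDlt : ∀ i < m, D.coeff i = 0 := fun i hi => by simp [hDc i hi.le, hxlt i hi]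
  have hNlt : ∀ i < m, N.coeff i = 0 := fun i hi => by simp [hNc i hi.le, hxlt i hi]
  have hDm : D.coeff m ≠ 0 := by
    rw [hDc m le_rfl]
    exact mul_ne_zero ha1.ne' (mul_ne_zero (by linarith) hc)
  have hD0 : D ≠ 0 := by
    rintro h
    simp [h] at hDm
  have hgD : D * g = N := by rw [hg, mul_div_cancel₀ _ hD0]
  have hglt : ∀ i < 0, g.coeff i = 0 := by
    by_contra! hcon
    obtain ⟨i, hi, hgi⟩ := hcon
    have hg0 : g ≠ 0 := by
      rintro h
      simp [h] at hgi
    have ho : g.order < 0 := lt_of_le_of_lt (HahnSeries.order_le_of_coeff_ne_zero hgi) hi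
    have hmul := LaurentSeries.coeff_mul_add hDlt
      (fun j hj => HahnSeries.coeff_eq_zero_of_lt_order (x := g) hj)
    rw [hgD, hNlt _ (by omega)] at hmul
    exact mul_ne_zero hDm (HahnSeries.coeff_order_eq_zero.not.mpr hg0) hmul.symm
  have hgm : g.coeff 0 = m := by
    have hmul := LaurentSeries.coeff_mul_add hDlt hglt
    rw [hgD, add_zero, hNc m le_rfl] at hmul
    refine mul_left_cancel₀ hDm (hmul.symm.trans ?_)
    rw [hDc m le_rfl]
    ring
  have hθlt : ∀ i < 0, θg.coeff i = 0 := fun i hi => by rw [hθg, hglt i hi, mul_zero]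
  have hxg : (x * g).coeff m = x.coeff m * m := by
    simpa [hgm] using LaurentSeries.coeff_mul_add hxlt hglt
  have hxgg : (x * g ^ 2).coeff m = x.coeff m * m * m := by
    have := LaurentSeries.coeff_mul_add (p := m)
      (fun i hi => LaurentSeries.coeff_mul_of_lt hxlt hglt (by omega)) hglt
    rw [add_zero, hxg, hgm] at this
    rw [← this, pow_two, mul_assoc]
  have hxθ : (x * θg).coeff m = 0 := by
    simpa [hθg] using LaurentSeries.coeff_mul_add hxlt hθlt
  have hyg : ((y - (4 : ℝ) • x) * g).coeff m = m * x.coeff m * m := by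
    have := LaurentSeries.coeff_mul_add (f := y - (4 : ℝ) • x) (p := m)
      (fun i hi => by simp [hy, hxlt i hi]) hglt
    rw [add_zero, hgm] at this
    rw [this]
    simp only [HahnSeries.coeff_sub, HahnSeries.coeff_smul, hy, smul_eq_mul]
    ring
  have hm3 : m ≠ -3 := by omega
  have key := congrArg (fun f : LaurentSeries ℝ => f.coeff m) heq
  simp only [HahnSeries.coeff_add, HahnSeries.coeff_sub, HahnSeries.coeff_smul, hxg, hxgg, hxθ,
    hyg, hDc m le_rfl, HahnSeries.coeff_single_of_ne hm3, smul_eq_mul] at key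
  have hμ0 : 0 < μ := by linarith
  have hquad : -((m : ℝ) * (m + 3)) * μ = a0 * (m + 4) := by
    field_simp at key
    apply mul_left_cancel₀ (mul_ne_zero hc ha1.ne')
    linarith
  subst hμ
  nlinarith [mul_pos ha0 ha1, mul_nonneg ha0.le (by linarith : 0 ≤ -5 - (m : ℝ)),
    mul_nonneg ha0.le (sq_nonneg (-5 - (m : ℝ))),
    mul_pos ha1 (mul_pos (by linarith : 0 < -(m : ℝ)) (by linarith : 0 < -((m : ℝ) + 3)))]
end

section
/- Under the Laurent setup, suppose x ∈ K is nonzero with x.order = m for some integer m ≤ −5, and let r = x.coeff m (so r ≠ 0). Then N and D are nonzero of order m with leading coefficients N.coeff m = ã₁·m·(m+4)·r and D.coeff m = ã₁·(m+4)·r, and the quotient g = N/D has g.order = 0 with constant term g.coeff 0 = m. -/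
/-- A Hahn series whose coefficients vanish below `m` but not at `m` has order `m`. -/
theorem HahnSeries.order_eq_of_coeff_ne_zero {Γ R : Type*} [LinearOrder Γ] [Zero Γ] [Zero R]
    {f : HahnSeries Γ R} {m : Γ} (hne : f.coeff m ≠ 0) (hlt : ∀ n < m, f.coeff n = 0) :
    f.order = m := by
  have hf : f ≠ 0 := by
    rintro rfl
    exact hne HahnSeries.coeff_zero
  exact le_antisymm (HahnSeries.order_le_of_coeff_ne_zero hne)
    ((HahnSeries.le_order_iff_forall hf).2 hlt)

/-- under the Laurent setup, if `x ≠ 0` has `x.order = m ≤ −5` with leading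
coefficient `r = x.coeff m`, then `N` and `D` are nonzero of order `m` with leading
coefficients `N.coeff m = ã₁·m·(m+4)·r` and `D.coeff m = ã₁·(m+4)·r`, and `g = N/D` has
`g.order = 0` with constant term `g.coeff 0 = m`. -/
theorem stmt2 (a0 a1 : ℝ) (ha0 : 0 < a0) (ha1 : 0 < a1)
    (μ : ℝ) (hμ : μ = a0 + a1)
    (x y z D N g : LaurentSeries ℝ)
    (hy : ∀ n : ℤ, y.coeff n = ((n : ℝ) + 4) * x.coeff n)
    (hz : ∀ n : ℤ, z.coeff n = (n : ℝ) * ((n : ℝ) + 4) * x.coeff n)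
    (hD : D = a1 • y + a0 • (HahnSeries.single (-3 : ℤ) (1 : ℝ)))
    (hN : N = a1 • z - (3 * a0) • (HahnSeries.single (-3 : ℤ) (1 : ℝ)))
    (hg : g = N / D)
    (hx : x ≠ 0) (m : ℤ) (hm : m ≤ -5) (hord : x.order = m)
    (r : ℝ) (hr : r = x.coeff m) :
    N ≠ 0 ∧ D ≠ 0 ∧ N.order = m ∧ D.order = m ∧
      N.coeff m = a1 * (m : ℝ) * ((m : ℝ) + 4) * r ∧
      D.coeff m = a1 * ((m : ℝ) + 4) * r ∧
      g.order = 0 ∧ g.coeff 0 = (m : ℝ) := by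
  have hr0 : r ≠ 0 := by
    rw [hr, ← hord]
    exact fun h => hx (HahnSeries.coeff_order_eq_zero.1 h)
  have hxlt : ∀ n < m, x.coeff n = 0 := fun n hn =>
    HahnSeries.coeff_eq_zero_of_lt_order (hord ▸ hn)
  have hDc : ∀ n ≤ m, D.coeff n = a1 * ((n : ℝ) + 4) * x.coeff n := by
    intro n hn
    have hn3 : n ≠ -3 := by lia
    simp [hD, hy, HahnSeries.coeff_single_of_ne hn3, mul_assoc]
  have hNc : ∀ n ≤ m, N.coeff n = a1 * (n : ℝ) * ((n : ℝ) + 4) * x.coeff n := by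
    intro n hn
    have hn3 : n ≠ -3 := by lia
    simp [hN, hz, HahnSeries.coeff_single_of_ne hn3, mul_assoc]
  have hmR : (m : ℝ) ≤ -5 := by exact_mod_cast hm
  have hm0 : (m : ℝ) ≠ 0 := by linarith
  have hm4 : (m : ℝ) + 4 ≠ 0 := by linarith
  have hDm : D.coeff m = a1 * ((m : ℝ) + 4) * r := by rw [hDc m le_rfl, hr]
  have hNm : N.coeff m = a1 * (m : ℝ) * ((m : ℝ) + 4) * r := by rw [hNc m le_rfl, hr]
  have hDne : D.coeff m ≠ 0 := by
    rw [hDm]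
    exact mul_ne_zero (mul_ne_zero ha1.ne' hm4) hr0
  have hNne : N.coeff m ≠ 0 := by
    rw [hNm]
    exact mul_ne_zero (mul_ne_zero (mul_ne_zero ha1.ne' hm0) hm4) hr0
  have hDord : D.order = m := HahnSeries.order_eq_of_coeff_ne_zero hDne fun n hn => by
    rw [hDc n hn.le, hxlt n hn, mul_zero]
  have hNord : N.order = m := HahnSeries.order_eq_of_coeff_ne_zero hNne fun n hn => by
    rw [hNc n hn.le, hxlt n hn, mul_zero]
  have hD0 : D ≠ 0 := by
    rintro h
    simp [h] at hDne
  have hN0 : N ≠ 0 := by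
    rintro h
    simp [h] at hNne
  have hgD : g * D = N := by rw [hg, div_mul_cancel₀ N hD0]
  have hg0 : g ≠ 0 := hg ▸ div_ne_zero hN0 hD0
  have hgord : g.order = 0 := by
    have h := HahnSeries.order_mul hg0 hD0
    rw [hgD, hNord, hDord] at h
    lia
  refine ⟨hN0, hD0, hNord, hDord, hNm, hDm, hgord, ?_⟩
  have h := HahnSeries.coeff_mul_order_add_order g D
  rw [hgD, HahnSeries.leadingCoeff_eq, HahnSeries.leadingCoeff_eq, hgord, hDord, zero_add, hNm]
    at h
  refine mul_right_cancel₀ hDne (h.symm.trans ?_)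
  rw [hDm]
  ring
end

section
/- Let ã₀ > 0, ã₁ > 0, μ̃ = ã₀ + ã₁, and let χ, A₁, A₂, A₃, A₄ be real numbers with A₄ + χ ≠ 0. Then the following three equations hold simultaneously: (i) 3·(A₄ + χ)·(1 + (ã₁/μ̃)·A₃)² = 0; (ii) 2·(1 + (ã₁/μ̃)·A₃)·[(ã₀/μ̃)·(1 + (ã₁/μ̃)·A₃)·A₃ + (4·ã₁/μ̃)·(A₄ + χ)·A₂] = 0; (iii) (1 + (ã₁/μ̃)·A₃)·[4·(ã₀/μ̃)·(1 + 3·(ã₁/μ̃)·A₃)·A₂ − (3·A₂ + (ã₁/μ̃)·(A₂·(2 + 5·A₃) − 18·A₁·(A₄ + χ)))] = 0, if and only if A₃ = −μ̃/ã₁. Moreover, in that case A₃ = −(ã₀ + ã₁)/ã₁ < −1. -/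
/-- eqs. (19)–(22) of the paper: for `ã₀, ã₁ > 0`, `μ̃ = ã₀ + ã₁`, and reals
`χ, A₁, A₂, A₃, A₄` with `A₄ + χ ≠ 0`, the three coefficient relations of orders
`a⁻¹⁰, a⁻⁹, a⁻⁸` hold simultaneously iff `A₃ = −μ̃/ã₁`; moreover in that case
`A₃ = −(ã₀+ã₁)/ã₁ < −1`. -/
theorem stmt3 (a0 a1 μ χ A1 A2 A3 A4 : ℝ)
    (ha0 : 0 < a0) (ha1 : 0 < a1) (hμ : μ = a0 + a1) (hA : A4 + χ ≠ 0) :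
    ((3 * (A4 + χ) * (1 + (a1 / μ) * A3) ^ 2 = 0 ∧
      2 * (1 + (a1 / μ) * A3) *
        ((a0 / μ) * (1 + (a1 / μ) * A3) * A3 + (4 * a1 / μ) * (A4 + χ) * A2) = 0 ∧
      (1 + (a1 / μ) * A3) *
        (4 * (a0 / μ) * (1 + 3 * (a1 / μ) * A3) * A2 -
          (3 * A2 + (a1 / μ) * (A2 * (2 + 5 * A3) - 18 * A1 * (A4 + χ)))) = 0)
      ↔ A3 = -μ / a1) ∧
    (A3 = -μ / a1 → A3 = -(a0 + a1) / a1 ∧ A3 < -1) := by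
  have hμ0 : μ ≠ 0 := by rw [hμ]; positivity
  have key : 1 + (a1 / μ) * A3 = 0 ↔ A3 = -μ / a1 := by
    constructor
    · intro h
      field_simp at h ⊢
      linarith
    · rintro rfl
      field_simp
      ring
  refine ⟨⟨fun h => ?_, fun h => ?_⟩, fun h => ?_⟩
  · have hsq := (mul_eq_zero.mp h.1).resolve_left (mul_ne_zero three_ne_zero hA)
    exact key.mp (pow_eq_zero_iff two_ne_zero |>.mp hsq)
  · rw [← key] at h
    simp [h]
  · rw [hμ] at h
    refine ⟨h, ?_⟩
    rw [h, div_lt_iff₀ ha1]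
    linarith
end

section
/- Under the Laurent setup, suppose x.coeff n = 0 for all integers n < −4, x.coeff(−3) = −ã₀/ã₁, and x.coeff(−2) ≠ 0. Then N and D are nonzero with N.coeff n = D.coeff n = 0 for all n < −2, and the quotient g = N/D satisfies g.coeff n = 0 for all n < 0 and g.coeff 0 = −2. (Since the torsion scalar is Φ̃ = −(3/2)·H̃·g, this says Φ̃ ≃ 3·H̃ at leading order in the high-redshift regime.) -/
namespace HahnSeries

/-- A Hahn series whose first nonzero coefficient sits in degree `n` has order `n`. -/
theorem order_eq_of_coeff_ne_zero_s8 {Γ R : Type*} [LinearOrder Γ] [Zero Γ] [Zero R]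
    {x : HahnSeries Γ R} {n : Γ} (h : ∀ m < n, x.coeff m = 0) (hn : x.coeff n ≠ 0) :
    x.order = n :=
  le_antisymm (order_le_of_coeff_ne_zero hn)
    ((le_order_iff_forall (ne_zero_of_coeff_ne_zero hn)).2 h)

/-- The quotient of two Hahn series of the same order has nonnegative order, and its constant
coefficient is the quotient of the leading coefficients. -/
theorem coeff_div_of_order_eq {Γ R : Type*} [AddCommGroup Γ] [LinearOrder Γ]
    [IsOrderedAddMonoid Γ] [Field R] {x y : HahnSeries Γ R} (hx : x ≠ 0) (hy : y ≠ 0)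
    (h : x.order = y.order) :
    (∀ n < 0, (x / y).coeff n = 0) ∧ (x / y).coeff 0 = x.leadingCoeff / y.leadingCoeff := by
  have hxy : x / y * y = x := div_mul_cancel₀ x hy
  have h0 : (x / y).order = 0 := by
    have := order_mul (div_ne_zero hx hy) hy
    rw [hxy, h] at this
    exact left_eq_add.1 (this.trans (add_comm _ _))
  refine ⟨fun n hn ↦ coeff_eq_zero_of_lt_order (by rwa [h0]), ?_⟩
  have hl := leadingCoeff_mul (x / y) y
  rw [hxy] at hl
  rw [hl, mul_div_cancel_right₀ _ (leadingCoeff_ne_zero.2 hy), leadingCoeff_eq, h0]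

end HahnSeries

/-- under the Laurent setup, if `x.coeff n = 0` for all `n < −4`,
`x.coeff (−3) = −ã₀/ã₁`, and `x.coeff (−2) ≠ 0`, then `N` and `D` are nonzero with all
coefficients below degree `−2` vanishing, and `g = N/D` satisfies `g.coeff n = 0` for all
`n < 0` and `g.coeff 0 = −2` (i.e. `Φ̃ ≃ 3H̃` at leading order at high redshift). -/
theorem stmt8 (a0 a1 : ℝ) (ha0 : 0 < a0) (ha1 : 0 < a1)
    (μ : ℝ) (hμ : μ = a0 + a1)
    (x y z D N g : LaurentSeries ℝ)
    (hy : ∀ n : ℤ, y.coeff n = ((n : ℝ) + 4) * x.coeff n)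
    (hz : ∀ n : ℤ, z.coeff n = (n : ℝ) * ((n : ℝ) + 4) * x.coeff n)
    (hD : D = a1 • y + a0 • (HahnSeries.single (-3 : ℤ) (1 : ℝ)))
    (hN : N = a1 • z - (3 * a0) • (HahnSeries.single (-3 : ℤ) (1 : ℝ)))
    (hg : g = N / D)
    (hx4 : ∀ n : ℤ, n < -4 → x.coeff n = 0)
    (hx3 : x.coeff (-3) = -a0 / a1)
    (hx2 : x.coeff (-2) ≠ 0) :
    N ≠ 0 ∧ D ≠ 0 ∧
      (∀ n : ℤ, n < -2 → N.coeff n = 0 ∧ D.coeff n = 0) ∧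
      (∀ n : ℤ, n < 0 → g.coeff n = 0) ∧ g.coeff 0 = -2 := by
  have hNc : ∀ n : ℤ, n ≠ -3 → N.coeff n = a1 * (n * (n + 4) * x.coeff n) := fun n hn ↦ by
    simp [hN, hz, HahnSeries.coeff_single_of_ne hn]
  have hDc : ∀ n : ℤ, n ≠ -3 → D.coeff n = a1 * ((n + 4) * x.coeff n) := fun n hn ↦ by
    simp [hD, hy, HahnSeries.coeff_single_of_ne hn]
  have hlow : ∀ n : ℤ, n < -2 → N.coeff n = 0 ∧ D.coeff n = 0 := by
    intro n hn
    obtain h | rfl | rfl : n < -4 ∨ n = -4 ∨ n = -3 := by omega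
    · rw [hNc n (by omega), hDc n (by omega), hx4 n h]
      simp
    · rw [hNc _ (by norm_num), hDc _ (by norm_num)]
      norm_num
    · constructor
      · simp only [hN, HahnSeries.coeff_sub, HahnSeries.coeff_smul, hz, hx3,
          HahnSeries.coeff_single_same, smul_eq_mul]
        push_cast
        field_simp
        ring
      · simp only [hD, HahnSeries.coeff_add, HahnSeries.coeff_smul, hy, hx3,
          HahnSeries.coeff_single_same, smul_eq_mul]
        push_cast
        field_simp
        ring
  have hN2 : N.coeff (-2) = -4 * (a1 * x.coeff (-2)) := by
    rw [hNc _ (by norm_num)]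
    push_cast
    ring
  have hD2 : D.coeff (-2) = 2 * (a1 * x.coeff (-2)) := by
    rw [hDc _ (by norm_num)]
    push_cast
    ring
  have hax : a1 * x.coeff (-2) ≠ 0 := mul_ne_zero ha1.ne' hx2
  have hN2' : N.coeff (-2) ≠ 0 := hN2 ▸ mul_ne_zero (by norm_num) hax
  have hD2' : D.coeff (-2) ≠ 0 := hD2 ▸ mul_ne_zero (by norm_num) hax
  have hN0 : N ≠ 0 := HahnSeries.ne_zero_of_coeff_ne_zero hN2'
  have hD0 : D ≠ 0 := HahnSeries.ne_zero_of_coeff_ne_zero hD2'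
  have hNo := HahnSeries.order_eq_of_coeff_ne_zero_s8 (fun m hm ↦ (hlow m hm).1) hN2'
  have hDo := HahnSeries.order_eq_of_coeff_ne_zero_s8 (fun m hm ↦ (hlow m hm).2) hD2'
  obtain ⟨hneg, hzero⟩ := HahnSeries.coeff_div_of_order_eq hN0 hD0 (hNo.trans hDo.symm)
  subst hg
  refine ⟨hN0, hD0, hlow, hneg, ?_⟩
  rw [hzero, HahnSeries.leadingCoeff_eq, HahnSeries.leadingCoeff_eq, hNo, hDo, hN2, hD2,
    mul_div_mul_right _ _ hax]
  norm_num
end
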